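/- arXiv:2110.11110 — 2 statements merged into one kernel-verified Lean document; each statement's English description precedes it below -/
import Mathlib

section
/- Consider a secretive shared-cache scheme with parameters (Λ, K, M, M_U = 1, N, B) and rate R, with users ordered so that user k is attached to cache λ(k) = min{λ ∈ [Λ] : L_1 + ⋯ + L_λ ≥ k}. Then for every integer s with 1 ≤ s ≤ min(N/2, K), R ≥ s − (λ(s) − 1)·M/(⌊N/s⌋ − 1); equivalently, R ≥ max over such s of (s − (λ(s)−1)M/(⌊N/s⌋−1)). -/
noncomputable section

/-- Probability of an event `E` on a finite sample space with weight function `p`. -/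
def pr {Ω : Type*} [Fintype Ω] (p : Ω → ℝ) (E : Set Ω) : ℝ :=
  ∑ ω : Ω, E.indicator p ω

/-- Shannon entropy (in bits) of a random variable `X` on a finite probability space
`(Ω, p)`: `H(X) = -∑_x P[X = x] log₂ P[X = x]`, written as the expectation
`∑_ω p ω · (− log₂ P[X = X ω])`. -/
def ent {Ω α : Type*} [Fintype Ω] (p : Ω → ℝ) (X : Ω → α) : ℝ :=
  ∑ ω : Ω, p ω * (-Real.logb 2 (pr p {ω' | X ω' = X ω}))

/-- Conditional Shannon entropy `H(X | Y) = H(X, Y) − H(Y)` in bits. -/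
def condEnt {Ω α β : Type*} [Fintype Ω] (p : Ω → ℝ) (X : Ω → α) (Y : Ω → β) : ℝ :=
  ent p (fun ω => (X ω, Y ω)) - ent p Y

/-- Mutual information `I(X ; Y) = H(X) + H(Y) − H(X, Y)` in bits. -/
def mutInf {Ω α β : Type*} [Fintype Ω] (p : Ω → ℝ) (X : Ω → α) (Y : Ω → β) : ℝ :=
  ent p X + ent p Y - ent p (fun ω => (X ω, Y ω))

section Entropy

variable {Ω : Type*} [Fintype Ω] {p : Ω → ℝ}

lemma pr_mono_of_support (hp : ∀ ω, 0 ≤ p ω) {E F : Set Ω}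
    (h : ∀ ω ∈ E, 0 < p ω → ω ∈ F) : pr p E ≤ pr p F := by
  classical
  refine Finset.sum_le_sum fun ω _ => ?_
  by_cases hE : ω ∈ E
  · rcases (hp ω).eq_or_lt with h0 | h0
    · by_cases hF : ω ∈ F <;> simp [Set.indicator, hE, hF, ← h0]
    · simp [hE, h ω hE h0]
  · by_cases hF : ω ∈ F <;> simp [hE, hF, hp ω]

lemma le_pr_of_mem (hp : ∀ ω, 0 ≤ p ω) {E : Set Ω} {ω : Ω} (h : ω ∈ E) : p ω ≤ pr p E := by
  classical
  calc p ω = E.indicator p ω := by simp [h]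
    _ ≤ pr p E := Finset.single_le_sum (f := fun ω => E.indicator p ω)
        (fun i _ => Set.indicator_nonneg (fun ω _ => hp ω) i) (Finset.mem_univ ω)

lemma pr_fiber_pos (hp : ∀ ω, 0 ≤ p ω) {α : Type*} (F : Ω → α) {ω : Ω} (h : 0 < p ω) :
    0 < pr p {ω' | F ω' = F ω} :=
  h.trans_le (le_pr_of_mem hp rfl)

/-- A variable determined by `F` on the support of `p` has at most the entropy of `F`. -/
lemma ent_le_ent_of_determined (hp : ∀ ω, 0 ≤ p ω) {α β : Type*} (F : Ω → α) (G : Ω → β)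
    (h : ∀ ω ω', 0 < p ω → 0 < p ω' → F ω = F ω' → G ω = G ω') : ent p G ≤ ent p F := by
  refine Finset.sum_le_sum fun ω _ => ?_
  rcases (hp ω).eq_or_lt with h0 | h0
  · simp [← h0]
  · refine mul_le_mul_of_nonneg_left (neg_le_neg ?_) (hp ω)
    exact Real.logb_le_logb_of_le one_lt_two (pr_fiber_pos hp F h0)
      (pr_mono_of_support hp fun ω' hω' hpos => h ω' ω hpos h0 hω')

lemma eq_of_condEnt_eq_zero (hp : ∀ ω, 0 ≤ p ω) {α β : Type*} (A : Ω → α) (S : Ω → β)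
    (h : condEnt p A S = 0) {ω ω' : Ω} (hω : 0 < p ω) (hω' : 0 < p ω') (hS : S ω = S ω') :
    A ω = A ω' := by
  classical
  by_contra hne
  have hle : ∀ η ∈ Finset.univ, p η * (-Real.logb 2 (pr p {η' | S η' = S η})) ≤
      p η * (-Real.logb 2 (pr p {η' | (A η', S η') = (A η, S η)})) := by
    intro η _
    rcases (hp η).eq_or_lt with h0 | h0
    · simp [← h0]
    · refine mul_le_mul_of_nonneg_left (neg_le_neg ?_) (hp η)
      refine Real.logb_le_logb_of_le one_lt_two (pr_fiber_pos hp (fun η => (A η, S η)) h0)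
        (pr_mono_of_support hp ?_)
      intro η' hη' _
      exact (Prod.ext_iff.1 hη').2
  have heq := (Finset.sum_eq_sum_iff_of_le hle).1 (sub_eq_zero.1 h).symm ω (Finset.mem_univ ω)
  have hlog := neg_injective (mul_left_cancel₀ hω.ne' heq)
  have hpr := Real.logb_injOn_pos one_lt_two (pr_fiber_pos hp S hω)
    (pr_fiber_pos hp (fun η => (A η, S η)) hω) hlog
  have hlt : pr p {η' | (A η', S η') = (A ω, S ω)} < pr p {η' | S η' = S ω} := by
    refine Finset.sum_lt_sum (fun η _ => ?_) ⟨ω', Finset.mem_univ _, ?_⟩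
    · refine Set.indicator_le_indicator_of_subset ?_ hp η
      intro η' hη'
      exact (Prod.ext_iff.1 hη').2
    · simp [Set.indicator, hS, Ne.symm hne, hω']
  exact hlt.ne hpr.symm

lemma sum_mul_fiber_ratio_le_one (hp : ∀ ω, 0 ≤ p ω) (hp1 : ∑ ω, p ω = 1) {α β : Type*}
    (A : Ω → α) (S : Ω → β) :
    ∑ ω, p ω * (pr p {ω' | A ω' = A ω} * pr p {ω' | S ω' = S ω} /
      pr p {ω' | (A ω', S ω') = (A ω, S ω)}) ≤ 1 := by
  classical
  have key : ∀ ω₁ ω₂ : Ω, ∑ ω, (if A ω₁ = A ω ∧ S ω₂ = S ω then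
      p ω / pr p {ω' | (A ω', S ω') = (A ω, S ω)} else 0) ≤ 1 := by
    intro ω₁ ω₂
    calc _ = ∑ ω, ({ω' | (A ω', S ω') = (A ω₁, S ω₂)} : Set Ω).indicator p ω /
          pr p {ω' | (A ω', S ω') = (A ω₁, S ω₂)} := by
          refine Finset.sum_congr rfl fun ω _ => ?_
          split_ifs with h
          · simp [Set.indicator, h.1, h.2]
          · have : ¬ (A ω = A ω₁ ∧ S ω = S ω₂) := fun h' => h ⟨h'.1.symm, h'.2.symm⟩
            simp [Set.indicator, this]
      _ ≤ 1 := by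
          rw [← Finset.sum_div]
          exact div_self_le_one _
  calc _ = ∑ ω₁, ∑ ω₂, p ω₁ * p ω₂ * ∑ ω, (if A ω₁ = A ω ∧ S ω₂ = S ω then
        p ω / pr p {ω' | (A ω', S ω') = (A ω, S ω)} else 0) := by
        simp_rw [Finset.mul_sum]
        rw [Finset.sum_congr rfl fun ω₁ _ => Finset.sum_comm, Finset.sum_comm]
        refine Finset.sum_congr rfl fun ω _ => ?_
        rw [mul_div_assoc', mul_comm (p ω), mul_div_assoc]
        conv_lhs => rw [pr, pr, Finset.sum_mul_sum, Finset.sum_mul]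
        refine Finset.sum_congr rfl fun ω₁ _ => ?_
        rw [Finset.sum_mul]
        refine Finset.sum_congr rfl fun ω₂ _ => ?_
        by_cases h₁ : A ω₁ = A ω <;> by_cases h₂ : S ω₂ = S ω <;>
          simp [Set.indicator, h₁, h₂]
    _ ≤ ∑ ω₁, ∑ ω₂, p ω₁ * p ω₂ * 1 := by
        gcongr with ω₁ _ ω₂ _
        · exact mul_nonneg (hp ω₁) (hp ω₂)
        · exact key ω₁ ω₂
    _ = 1 := by simp [← Finset.mul_sum, hp1]

/-- Subadditivity of entropy. -/
lemma ent_pair_le (hp : ∀ ω, 0 ≤ p ω) (hp1 : ∑ ω, p ω = 1) {α β : Type*}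
    (A : Ω → α) (S : Ω → β) : ent p (fun ω => (A ω, S ω)) ≤ ent p A + ent p S := by
  have hlog2 : 0 < Real.log 2 := Real.log_pos one_lt_two
  rw [← sub_nonpos, ent, ent, ent, ← Finset.sum_add_distrib, ← Finset.sum_sub_distrib]
  calc _ ≤ ∑ ω, (p ω * (pr p {ω' | A ω' = A ω} * pr p {ω' | S ω' = S ω} /
        pr p {ω' | (A ω', S ω') = (A ω, S ω)}) - p ω) / Real.log 2 := by
        refine Finset.sum_le_sum fun ω _ => ?_
        rcases (hp ω).eq_or_lt with h0 | h0
        · simp [← h0]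
        · have hA := pr_fiber_pos hp A h0
          have hS := pr_fiber_pos hp S h0
          have hAS := pr_fiber_pos hp (fun ω => (A ω, S ω)) h0
          have h := Real.log_le_sub_one_of_pos (div_pos (mul_pos hA hS) hAS)
          rw [Real.log_div (mul_pos hA hS).ne' hAS.ne', Real.log_mul hA.ne' hS.ne'] at h
          rw [le_div_iff₀ hlog2]
          have h' := mul_le_mul_of_nonneg_left h h0.le
          simp only [Real.logb]
          field_simp
          field_simp at h'
          linarith
    _ ≤ 0 := by
        rw [← Finset.sum_div, Finset.sum_sub_distrib, hp1]
        exact div_nonpos_of_nonpos_of_nonneg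
          (sub_nonpos.2 (sum_mul_fiber_ratio_le_one hp hp1 A S)) hlog2.le

lemma ent_pair_le_of_le (hp : ∀ ω, 0 ≤ p ω) (hp1 : ∑ ω, p ω = 1) {α β : Type*}
    {A : Ω → α} {S : Ω → β} {a b : ℝ} (hA : ent p A ≤ a) (hS : ent p S ≤ b) :
    ent p (fun ω => (A ω, S ω)) ≤ a + b :=
  (ent_pair_le hp hp1 A S).trans (add_le_add hA hS)

lemma ent_tuple_le_sum (hp : ∀ ω, 0 ≤ p ω) (hp1 : ∑ ω, p ω = 1) {ι : Type*} {α : ι → Type*}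
    (Y : ∀ i, Ω → α i) (s : Finset ι) :
    ent p (fun ω (i : s) => Y i ω) ≤ ∑ i ∈ s, ent p (Y i) := by
  classical
  induction s using Finset.induction_on with
  | empty =>
    have h : ∀ ω : Ω, {ω' : Ω | (fun i : (∅ : Finset ι) => Y i.1 ω') =
        fun i : (∅ : Finset ι) => Y i.1 ω} = Set.univ := fun ω =>
      Set.eq_univ_of_forall fun ω' => Subsingleton.elim _ _
    simp [ent, h, pr, hp1]
  | insert a s ha ih =>
    rw [Finset.sum_insert ha]
    refine le_trans ?_ (ent_pair_le_of_le hp hp1 le_rfl ih)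
    refine ent_le_ent_of_determined hp _ _ fun ω ω' _ _ h => funext ?_
    rintro ⟨i, hi⟩
    rcases Finset.mem_insert.1 hi with rfl | hi
    · exact (Prod.ext_iff.1 h).1
    · exact congrFun (Prod.ext_iff.1 h).2 ⟨i, hi⟩

lemma ent_tuple_le_card_mul (hp : ∀ ω, 0 ≤ p ω) (hp1 : ∑ ω, p ω = 1) {ι : Type*}
    {α : ι → Type*} (Y : ∀ i, Ω → α i) (s : Finset ι) {c : ℝ} (h : ∀ i, ent p (Y i) ≤ c) :
    ent p (fun ω (i : s) => Y i ω) ≤ s.card * c :=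
  (ent_tuple_le_sum hp hp1 Y s).trans <| by
    simpa using Finset.sum_le_card_nsmul s _ c fun i _ => h i

lemma ent_eq_of_pr_fiber_eq (hp1 : ∑ ω, p ω = 1) {α : Type*} (F : Ω → α) (n : ℕ)
    (h : ∀ ω, pr p {ω' | F ω' = F ω} = 1 / 2 ^ n) : ent p F = n := by
  simp only [ent, h]
  rw [← Finset.sum_mul, hp1, one_div, Real.logb_inv, ← Real.rpow_natCast,
    Real.logb_rpow two_pos (by norm_num)]
  simp

end Entropy

/-- for any secretive shared-cache scheme with parameters
`(Λ, K, M, M_U = 1, N, B)` and rate `R`, with users ordered so that user `k` (1-indexed)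
is attached to cache `λ(k) = min{λ : L₁ + ⋯ + L_λ ≥ k}`, for every integer `s` with
`1 ≤ s ≤ min(N/2, K)` one has `R ≥ s − (λ(s) − 1)·M/(⌊N/s⌋ − 1)`.
Users, caches and files are 0-indexed via `Fin`, so user `s` is `⟨s−1,_⟩ : Fin K` and
`λ(s) − 1` is the `Fin Λ`-value `(lam ⟨s−1,_⟩).val`. -/
theorem statement12
    -- parameters (the user-cache memory is M_U = 1)
    (Λ K N B : ℕ) (M R : ℝ) (hΛ : 0 < Λ) (hB : 0 < B)
    -- association profile and user-to-cache assignment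
    (L : Fin Λ → ℕ) (hL : Antitone L) (hKsum : ∑ l : Fin Λ, L l = K)
    (lam : Fin K → Fin Λ)
    (hlam : ∀ k : Fin K, (k.val + 1 ≤ ∑ l ∈ Finset.Iic (lam k), L l) ∧
      ∀ l' : Fin Λ, k.val + 1 ≤ ∑ l ∈ Finset.Iic l', L l → lam k ≤ l')
    -- the underlying finite probability space
    (Ω : Type) [Fintype Ω] (p : Ω → ℝ) (hp0 : ∀ ω : Ω, 0 ≤ p ω) (hp1 : ∑ ω : Ω, p ω = 1)
    -- the `N` files: mutually independent, each uniform over a set of size `2^B`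
    (W : Fin N → Ω → Fin (2 ^ B))
    (hWunif : ∀ (n : Fin N) (w : Fin (2 ^ B)), pr p {ω | W n ω = w} = 1 / (2 ^ B : ℝ))
    (hWind : ∀ w : Fin N → Fin (2 ^ B),
      pr p {ω | ∀ n : Fin N, W n ω = w n} = ∏ n : Fin N, pr p {ω | W n ω = w n})
    -- helper-cache contents
    (ZT : Fin Λ → Type) (Z : ∀ l : Fin Λ, Ω → ZT l)
    (hZ : ∀ l : Fin Λ, ent p (Z l) ≤ M * B)
    -- user-cache contents, of size `M_U = 1` file
    (UT : Fin K → Type) (U : ∀ k : Fin K, Ω → UT k)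
    (hU : ∀ k : Fin K, ent p (U k) ≤ 1 * B)
    -- transmissions
    (XT : (Fin K → Fin N) → Type) (X : ∀ d : Fin K → Fin N, Ω → XT d)
    (hX : ∀ d : Fin K → Fin N, ent p (X d) ≤ R * B)
    -- decodability
    (hdec : ∀ (d : Fin K → Fin N) (k : Fin K),
      condEnt p (W (d k)) (fun ω => (X d ω, Z (lam k) ω, U k ω)) = 0)
    -- secrecy
    (hsec : ∀ (d : Fin K → Fin N) (k : Fin K),
      mutInf p (fun ω (n : {n : Fin N // n ≠ d k}) => W n.val ω)
        (fun ω => (X d ω, Z (lam k) ω, U k ω)) = 0) :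
    ∀ (s : ℕ), ∀ _hs1 : 1 ≤ s, ∀ _hs2 : 2 * s ≤ N, ∀ _hsK : s ≤ K,
      R ≥ (s : ℝ) -
        ((lam ⟨s - 1, by omega⟩).val : ℝ) * M / (((N / s : ℕ) : ℝ) - 1) := by
  intro s hs1 hs2 hsK
  classical
  have hN : 0 < N := by omega
  set k₀ : Fin K := ⟨s - 1, by omega⟩ with hk₀
  set m := N / s with hm
  have hm2 : 2 ≤ m := (Nat.le_div_iff_mul_le hs1).2 hs2
  have hmN : m * s ≤ N := Nat.div_mul_le_self N s
  let d : ℕ → Fin K → Fin N := fun i k => ⟨(i * s + k.val) % N, Nat.mod_lt _ hN⟩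
  have hd : ∀ i k n, i * s + k.val = n.val → d i k = n := fun i k n h =>
    Fin.ext (by simp [d, h, Nat.mod_eq_of_lt n.isLt])
  have hd₀ : (d 0 k₀).val = s - 1 := by
    simp only [d, hk₀, zero_mul, zero_add]
    exact Nat.mod_eq_of_lt (by omega)
  have hlam_le : ∀ k : Fin K, k.val < s → lam k ≤ lam k₀ := fun k hk =>
    (hlam k).2 _ (le_trans (by simp only [hk₀]; omega) (hlam k₀).1)
  have hWent : ∀ n, ent p (W n) = B := fun n =>
    ent_eq_of_pr_fiber_eq hp1 (W n) B fun ω => hWunif n (W n ω)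
  have hWall : ent p (fun ω n => W n ω) = (B * N : ℕ) := by
    refine ent_eq_of_pr_fiber_eq hp1 _ _ fun ω => ?_
    have h := hWind fun n => W n ω
    simp only [hWunif, Finset.prod_const, Finset.card_univ, Fintype.card_fin] at h
    simp only [funext_iff, h]
    rw [pow_mul, one_div_pow]
  let Y := fun ω => (X (d 0) ω, Z (lam k₀) ω, U k₀ ω)
  let V := fun ω (n : {n : Fin N // n ≠ d 0 k₀}) => W n.val ω
  have hV : (N - 1 : ℝ) * B ≤ ent p V := by
    have h : ent p (fun ω n => W n ω) ≤ ent p V + ent p (W (d 0 k₀)) := by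
      refine le_trans ?_ (ent_pair_le hp0 hp1 V _)
      refine ent_le_ent_of_determined hp0 _ _ fun ω ω' _ _ h => funext fun n => ?_
      by_cases hn : n = d 0 k₀
      · rw [hn]
        exact (Prod.ext_iff.1 h).2
      · exact congrFun (Prod.ext_iff.1 h).1 ⟨n, hn⟩
    rw [hWall, hWent] at h
    push_cast at h
    linarith
  let TX := fun ω (i : Finset.Ico 1 m) => X (d i) ω
  let TU := fun ω (k : Finset.Iio k₀) => U k ω
  let TZ := fun ω (l : Finset.Iio (lam k₀)) => Z l ω
  let TW := fun ω (n : (Finset.univ.filter fun n : Fin N => m * s ≤ n.val)) => W n ω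
  have hTX : ent p TX ≤ (m - 1 : ℝ) * (R * B) := by
    have h := ent_tuple_le_card_mul hp0 hp1 (fun i => X (d i)) (Finset.Ico 1 m) fun i => hX (d i)
    rwa [Nat.card_Ico, Nat.cast_sub (by omega), Nat.cast_one] at h
  have hTU : ent p TU ≤ (s - 1 : ℝ) * (1 * B) := by
    have h := ent_tuple_le_card_mul hp0 hp1 U (Finset.Iio k₀) hU
    rwa [Fin.card_Iio, Nat.cast_sub hs1, Nat.cast_one] at h
  have hTZ : ent p TZ ≤ ((lam k₀).val : ℝ) * (M * B) := by
    have h := ent_tuple_le_card_mul hp0 hp1 Z (Finset.Iio (lam k₀)) hZ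
    rwa [Fin.card_Iio] at h
  have hTW : ent p TW ≤ (N - m * s : ℝ) * B := by
    have h := ent_tuple_le_card_mul hp0 hp1 W
      (Finset.univ.filter fun n : Fin N => m * s ≤ n.val) fun n => (hWent n).le
    have hc : (Finset.univ.filter fun n : Fin N => m * s ≤ n.val).card = N - m * s := by
      have h₁ := Finset.card_filter_add_card_filter_not (s := (Finset.univ : Finset (Fin N)))
        (fun n : Fin N => n.val < m * s)
      have h₂ := Fin.card_filter_val_lt (n := N) (m := m * s)
      simp only [not_lt, Finset.card_univ, Fintype.card_fin] at h₁
      omega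
    rw [hc, Nat.cast_sub hmN] at h
    exact_mod_cast h
  have hVY : ent p (fun ω => (V ω, Y ω)) ≤
      ent p (fun ω => (Y ω, TX ω, TU ω, TZ ω, TW ω)) := by
    refine ent_le_ent_of_determined hp0 _ _ fun ω ω' hω hω' h => ?_
    simp only [Prod.mk.injEq] at h
    obtain ⟨hY, hTX, hTU, hTZ, hTW⟩ := h
    refine Prod.ext (funext ?_) hY
    rintro ⟨n, hn⟩
    simp only [Y, Prod.mk.injEq] at hY
    obtain ⟨hYX, hYZ, hYU⟩ := hY
    change W n ω = W n ω'
    rcases le_or_gt (m * s) n.val with hnm | hnm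
    · exact congrFun hTW ⟨n, by simpa using hnm⟩
    have hi : n.val / s < m := (Nat.div_lt_iff_lt_mul hs1).2 hnm
    have hks : n.val % s < s := Nat.mod_lt _ hs1
    obtain ⟨k, hk⟩ : ∃ k : Fin K, k.val = n.val % s := ⟨⟨n.val % s, by omega⟩, rfl⟩
    have hdn : d (n.val / s) k = n := hd _ _ _ (by rw [hk]; exact Nat.div_add_mod' n.val s)
    have hXeq : X (d (n.val / s)) ω = X (d (n.val / s)) ω' := by
      rcases Nat.eq_zero_or_pos (n.val / s) with h0 | h0
      · rw [h0]
        exact hYX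
      · exact congrFun hTX ⟨n.val / s, Finset.mem_Ico.2 ⟨h0, hi⟩⟩
    have hZeq : Z (lam k) ω = Z (lam k) ω' := by
      rcases (hlam_le k (hk ▸ hks)).eq_or_lt with h0 | h0
      · rw [h0]
        exact hYZ
      · exact congrFun hTZ ⟨lam k, Finset.mem_Iio.2 h0⟩
    have hUeq : U k ω = U k ω' := by
      have hle : k ≤ k₀ := Fin.le_def.2 (by simp only [hk₀]; omega)
      rcases hle.eq_or_lt with h0 | h0
      · rw [h0]
        exact hYU
      · exact congrFun hTU ⟨k, Finset.mem_Iio.2 h0⟩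
    have hW := eq_of_condEnt_eq_zero hp0 _ _ (hdec (d (n.val / s)) k) hω hω'
      (by rw [hXeq, hZeq, hUeq])
    rwa [hdn] at hW
  have hsub := ent_pair_le_of_le hp0 hp1 (le_refl (ent p Y))
    (ent_pair_le_of_le hp0 hp1 hTX (ent_pair_le_of_le hp0 hp1 hTU
      (ent_pair_le_of_le hp0 hp1 hTZ hTW)))
  have hsecret : ent p V + ent p Y - ent p (fun ω => (V ω, Y ω)) = 0 := hsec (d 0) k₀
  have hBpos : (0 : ℝ) < B := by exact_mod_cast hB
  have hm1 : (0 : ℝ) < (m : ℝ) - 1 := by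
    have : (2 : ℝ) ≤ m := by exact_mod_cast hm2
    linarith
  have hmain : ((m : ℝ) - 1) * s - (lam k₀).val * M ≤ R * (m - 1) := by
    refine le_of_mul_le_mul_right ?_ hBpos
    linarith
  rw [ge_iff_le, sub_le_iff_le_add, ← sub_le_iff_le_add', le_div_iff₀ hm1]
  linarith
end
end

section
/- Consider a secretive shared-cache scheme with parameters (Λ, K, M, M_U, N, B) in which cache 1 serves L_1 ≥ 2 users (users 1, …, L_1) and N ≥ L_1. Then L_1 ≤ 1 + (L_1 − 1)·M_U; in particular, M_U ≥ 1. That is, to ensure the secrecy constraint in a shared cache network where some helper cache serves at least two users, each user must have a dedicated cache of size at least one file. -/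
noncomputable section

section Entropy

variable {Ω α β γ δ : Type*} [Fintype Ω] {p : Ω → ℝ}

lemma pr_fiber_eq_sum (p : Ω → ℝ) (X : Ω → α) (a : α) [DecidablePred fun ω => X ω = a] :
    pr p {ω | X ω = a} = ∑ ω, if X ω = a then p ω else 0 := by
  classical
  simp [pr, Set.indicator_apply]

lemma pr_mono (hp : ∀ ω, 0 ≤ p ω) {E F : Set Ω} (h : E ⊆ F) : pr p E ≤ pr p F :=
  Finset.sum_le_sum fun ω _ => Set.indicator_le_indicator_of_subset h hp ω

lemma pr_nonneg (hp : ∀ ω, 0 ≤ p ω) (E : Set Ω) : 0 ≤ pr p E :=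
  Finset.sum_nonneg fun ω _ => Set.indicator_nonneg (fun ω _ => hp ω) ω

lemma pr_pos_of_mem (hp : ∀ ω, 0 ≤ p ω) {E : Set Ω} {ω : Ω} (hω : ω ∈ E) (h : 0 < p ω) :
    0 < pr p E := by
  refine lt_of_lt_of_le (by rwa [Set.indicator_of_mem hω])
    (Finset.single_le_sum (f := fun ω => E.indicator p ω)
      (fun ω _ => Set.indicator_nonneg (fun ω _ => hp ω) ω) (Finset.mem_univ ω))

/-- If `X` determines `Y`, then `H(Y) ≤ H(X)`. -/
lemma ent_le_of_determines (hp : ∀ ω, 0 ≤ p ω) {X : Ω → α} {Y : Ω → β}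
    (h : ∀ ω ω', X ω = X ω' → Y ω = Y ω') : ent p Y ≤ ent p X := by
  refine Finset.sum_le_sum fun ω _ => ?_
  rcases (hp ω).eq_or_lt with h0 | h0
  · simp [← h0]
  · refine mul_le_mul_of_nonneg_left (neg_le_neg ?_) (hp ω)
    exact Real.logb_le_logb_of_le one_lt_two
      (pr_pos_of_mem hp (E := {ω' | X ω' = X ω}) rfl h0) (pr_mono hp fun ω' h' => h _ _ h')

/-- The sum of likelihood ratios behind submodularity is at most one. -/
lemma sum_likelihood_ratio_le_one (hp : ∀ ω, 0 ≤ p ω) (hp1 : ∑ ω, p ω = 1)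
    {Y : Ω → α} {Z : Ω → β} {V : Ω → γ}
    (hY : ∀ ω ω', Y ω = Y ω' → V ω = V ω') (hZ : ∀ ω ω', Z ω = Z ω' → V ω = V ω') :
    ∑ ω, p ω * (pr p {ω' | Y ω' = Y ω} * pr p {ω' | Z ω' = Z ω} /
      (pr p {ω' | (Y ω', Z ω') = (Y ω, Z ω)} * pr p {ω' | V ω' = V ω})) ≤ 1 := by
  classical
  set f : Ω → ℝ := fun ω => pr p {ω' | (Y ω', Z ω') = (Y ω, Z ω)} with hf
  set v : Ω → ℝ := fun ω => pr p {ω' | V ω' = V ω} with hv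
  have hv0 : ∀ ω, 0 ≤ v ω := fun ω => pr_nonneg hp _
  have inner : ∀ a b, (∑ ω, if Y a = Y ω ∧ Z b = Z ω then p ω / (f ω * v ω) else 0) ≤
      if V b = V a then (v a)⁻¹ else 0 := by
    intro a b
    by_cases hex : ∃ c, Y a = Y c ∧ Z b = Z c
    · obtain ⟨c, hac, hbc⟩ := hex
      have hVc : V c = V a := (hY _ _ hac).symm
      rw [if_pos ((hZ _ _ hbc).trans hVc)]
      have hterm : ∀ ω, (if Y a = Y ω ∧ Z b = Z ω then p ω / (f ω * v ω) else 0) =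
          (if (Y ω, Z ω) = (Y c, Z c) then p ω else 0) * (f c * v a)⁻¹ := by
        intro ω
        by_cases h : Y a = Y ω ∧ Z b = Z ω
        · have hc : (Y ω, Z ω) = (Y c, Z c) := by
            rw [← h.1, ← h.2, hac, hbc]
          have hfω : f ω = f c := by simp only [hf, hc]
          have hvω : v ω = v a := by simp only [hv, ← hY _ _ h.1]
          rw [if_pos h, if_pos hc, hfω, hvω, div_eq_mul_inv]
        · have hc : ¬ (Y ω, Z ω) = (Y c, Z c) := by
            rw [Prod.mk.injEq]
            rintro ⟨h1, h2⟩
            exact h ⟨hac.trans h1.symm, hbc.trans h2.symm⟩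
          rw [if_neg h, if_neg hc, zero_mul]
      rw [Finset.sum_congr rfl fun ω _ => hterm ω, ← Finset.sum_mul,
        ← pr_fiber_eq_sum p (fun ω => (Y ω, Z ω)) (Y c, Z c)]
      change f c * (f c * v a)⁻¹ ≤ _
      rw [mul_inv, ← mul_assoc]
      exact mul_le_of_le_one_left (inv_nonneg.2 (hv0 a)) mul_inv_le_one
    · rw [Finset.sum_eq_zero fun ω _ => if_neg fun h => hex ⟨ω, h⟩]
      split_ifs
      · exact inv_nonneg.2 (hv0 a)
      · exact le_rfl
  calc _ = ∑ ω, ∑ a, ∑ b, p a * (p b *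
          if Y a = Y ω ∧ Z b = Z ω then p ω / (f ω * v ω) else 0) := by
        refine Finset.sum_congr rfl fun ω _ => ?_
        change p ω * (_ / (f ω * v ω)) = _
        rw [pr_fiber_eq_sum p Y, pr_fiber_eq_sum p Z, mul_div_left_comm, Finset.sum_mul_sum,
          Finset.sum_mul]
        refine Finset.sum_congr rfl fun a _ => ?_
        rw [Finset.sum_mul]
        refine Finset.sum_congr rfl fun b _ => ?_
        by_cases h1 : Y a = Y ω <;> by_cases h2 : Z b = Z ω <;> simp [h1, h2, mul_assoc]
    _ = ∑ a, ∑ b, p a * (p b *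
          ∑ ω, if Y a = Y ω ∧ Z b = Z ω then p ω / (f ω * v ω) else 0) := by
        rw [Finset.sum_comm]
        refine Finset.sum_congr rfl fun a _ => ?_
        rw [Finset.sum_comm]
        simp only [Finset.mul_sum]
    _ ≤ ∑ a, ∑ b, p a * (p b * if V b = V a then (v a)⁻¹ else 0) :=
        Finset.sum_le_sum fun a _ => Finset.sum_le_sum fun b _ =>
          mul_le_mul_of_nonneg_left (mul_le_mul_of_nonneg_left (inner a b) (hp b)) (hp a)
    _ = ∑ a, p a * (v a * (v a)⁻¹) := by
        refine Finset.sum_congr rfl fun a _ => ?_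
        rw [← Finset.mul_sum]
        congr 1
        change _ = pr p {ω' | V ω' = V a} * _
        rw [pr_fiber_eq_sum p V, Finset.sum_mul]
        exact Finset.sum_congr rfl fun b _ => by split_ifs <;> simp
    _ ≤ ∑ a, p a := Finset.sum_le_sum fun a _ => mul_le_of_le_one_right (hp a) mul_inv_le_one
    _ = 1 := hp1

/-- Submodularity of entropy: if both `Y` and `Z` determine `V`, then
`H(Y, Z) + H(V) ≤ H(Y) + H(Z)`. -/
lemma ent_prod_add_le (hp : ∀ ω, 0 ≤ p ω) (hp1 : ∑ ω, p ω = 1)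
    {Y : Ω → α} {Z : Ω → β} {V : Ω → γ}
    (hY : ∀ ω ω', Y ω = Y ω' → V ω = V ω') (hZ : ∀ ω ω', Z ω = Z ω' → V ω = V ω') :
    ent p (fun ω => (Y ω, Z ω)) + ent p V ≤ ent p Y + ent p Z := by
  have key := sum_likelihood_ratio_le_one hp hp1 hY hZ
  have hlog : (0 : ℝ) < Real.log 2 := Real.log_pos one_lt_two
  rw [← sub_nonpos]
  simp only [ent]
  rw [← Finset.sum_add_distrib, ← Finset.sum_add_distrib, ← Finset.sum_sub_distrib]
  refine (Finset.sum_le_sum (g := fun ω => (p ω * (pr p {ω' | Y ω' = Y ω} *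
    pr p {ω' | Z ω' = Z ω} / (pr p {ω' | (Y ω', Z ω') = (Y ω, Z ω)} *
      pr p {ω' | V ω' = V ω})) - p ω) / Real.log 2) fun ω _ => ?_).trans ?_
  · rcases (hp ω).eq_or_lt with h0 | h0
    · simp [← h0]
    · have py := pr_pos_of_mem hp (E := {ω' | Y ω' = Y ω}) rfl h0
      have pz := pr_pos_of_mem hp (E := {ω' | Z ω' = Z ω}) rfl h0
      have pv := pr_pos_of_mem hp (E := {ω' | V ω' = V ω}) rfl h0
      have px := pr_pos_of_mem hp (E := {ω' | (Y ω', Z ω') = (Y ω, Z ω)}) rfl h0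
      have h := Real.log_le_sub_one_of_pos (div_pos (mul_pos py pz) (mul_pos px pv))
      rw [Real.log_div (mul_pos py pz).ne' (mul_pos px pv).ne', Real.log_mul py.ne' pz.ne',
        Real.log_mul px.ne' pv.ne'] at h
      have h' := mul_le_mul_of_nonneg_left h h0.le
      rw [le_div_iff₀ hlog]
      simp only [Real.logb]
      field_simp
      field_simp at h'
      linarith
  · rw [← Finset.sum_div, Finset.sum_sub_distrib, hp1]
    exact div_nonpos_of_nonpos_of_nonneg (sub_nonpos.2 key) hlog.le

lemma ent_const (hp1 : ∑ ω, p ω = 1) (a : α) : ent p (fun _ : Ω => a) = 0 := by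
  simp [ent, pr, hp1]

/-- Subadditivity of entropy. -/
lemma ent_prod_le (hp : ∀ ω, 0 ≤ p ω) (hp1 : ∑ ω, p ω = 1) (Y : Ω → α) (Z : Ω → β) :
    ent p (fun ω => (Y ω, Z ω)) ≤ ent p Y + ent p Z := by
  simpa [ent_const hp1] using
    ent_prod_add_le hp hp1 (Y := Y) (Z := Z) (V := fun _ => ()) (by simp) (by simp)

/-- Entropy of a uniform `B`-bit string. -/
lemma ent_uniform (hp1 : ∑ ω, p ω = 1) {B : ℕ} {W : Ω → α}
    (hW : ∀ w, pr p {ω | W ω = w} = 1 / (2 ^ B : ℝ)) : ent p W = B := by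
  simp [ent, hW, Real.logb_inv, Real.logb_pow, ← Finset.sum_mul, hp1]

/-- Data processing for `mutInf = 0`: it is inherited by functions of either variable. -/
lemma ent_add_le_of_mutInf_eq_zero (hp : ∀ ω, 0 ≤ p ω) (hp1 : ∑ ω, p ω = 1)
    {A : Ω → α} {A' : Ω → β} {C : Ω → γ} {C' : Ω → δ} (h : mutInf p A C = 0)
    (hA : ∀ ω ω', A ω = A ω' → A' ω = A' ω') (hC : ∀ ω ω', C ω = C ω' → C' ω = C' ω') :
    ent p A' + ent p C' ≤ ent p (fun ω => (A' ω, C' ω)) := by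
  have h1 := ent_prod_add_le hp hp1 (Y := A) (Z := fun ω => (A' ω, C ω)) (V := A') hA
    fun ω ω' e => (Prod.mk.inj e).1
  have h2 := ent_prod_add_le hp hp1 (Y := fun ω => (A' ω, C' ω)) (Z := C) (V := C')
    (fun ω ω' e => (Prod.mk.inj e).2) hC
  have h3 : ent p (fun ω => (A ω, C ω)) ≤ ent p (fun ω => (A ω, (A' ω, C ω))) :=
    ent_le_of_determines hp fun ω ω' e => by simp_all
  have h4 : ent p (fun ω => (A' ω, C ω)) ≤ ent p (fun ω => ((A' ω, C' ω), C ω)) :=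
    ent_le_of_determines hp fun ω ω' e => by simp_all
  unfold mutInf at h
  linarith

end Entropy

/-- in any secretive shared-cache scheme with parameters
`(Λ, K, M, M_U, N, B)` in which cache 1 serves `L₁ ≥ 2` users (users `1, …, L₁`, i.e. the
users `k` with `k.val < L₁` under 0-indexing) and `N ≥ L₁`, one has
`L₁ ≤ 1 + (L₁ − 1)·M_U`; in particular `M_U ≥ 1`. That is, to ensure the secrecy
constraint in a shared-cache network where some helper cache serves at least two users,
each user must have a dedicated cache of size at least one file. -/
theorem statement13
    -- parameters
    (Λ K N B : ℕ) (M MU : ℝ) (hΛ : 0 < Λ) (hB : 0 < B)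
    -- association profile and user-to-cache assignment; cache 1 serves users 1,…,L₁
    (L : Fin Λ → ℕ) (hL : Antitone L) (hKsum : ∑ l : Fin Λ, L l = K)
    (lam : Fin K → Fin Λ)
    (hlam1 : ∀ k : Fin K, k.val < L ⟨0, hΛ⟩ → lam k = ⟨0, hΛ⟩)
    (hL1 : 2 ≤ L ⟨0, hΛ⟩) (hN : L ⟨0, hΛ⟩ ≤ N)
    -- the underlying finite probability space
    (Ω : Type) [Fintype Ω] (p : Ω → ℝ) (hp0 : ∀ ω : Ω, 0 ≤ p ω) (hp1 : ∑ ω : Ω, p ω = 1)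
    -- the `N` files: mutually independent, each uniform over a set of size `2^B`
    (W : Fin N → Ω → Fin (2 ^ B))
    (hWunif : ∀ (n : Fin N) (w : Fin (2 ^ B)), pr p {ω | W n ω = w} = 1 / (2 ^ B : ℝ))
    (hWind : ∀ w : Fin N → Fin (2 ^ B),
      pr p {ω | ∀ n : Fin N, W n ω = w n} = ∏ n : Fin N, pr p {ω | W n ω = w n})
    -- helper-cache contents
    (ZT : Fin Λ → Type) (Z : ∀ l : Fin Λ, Ω → ZT l)
    (hZ : ∀ l : Fin Λ, ent p (Z l) ≤ M * B)
    -- user-cache contents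
    (UT : Fin K → Type) (U : ∀ k : Fin K, Ω → UT k)
    (hU : ∀ k : Fin K, ent p (U k) ≤ MU * B)
    -- transmissions
    (XT : (Fin K → Fin N) → Type) (X : ∀ d : Fin K → Fin N, Ω → XT d)
    -- decodability
    (hdec : ∀ (d : Fin K → Fin N) (k : Fin K),
      condEnt p (W (d k)) (fun ω => (X d ω, Z (lam k) ω, U k ω)) = 0)
    -- secrecy
    (hsec : ∀ (d : Fin K → Fin N) (k : Fin K),
      mutInf p (fun ω (n : {n : Fin N // n ≠ d k}) => W n.val ω)
        (fun ω => (X d ω, Z (lam k) ω, U k ω)) = 0) :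
    (L ⟨0, hΛ⟩ : ℝ) ≤ 1 + ((L ⟨0, hΛ⟩ : ℝ) - 1) * MU ∧ 1 ≤ MU := by
  have hK : L ⟨0, hΛ⟩ ≤ K := hKsum ▸ Finset.single_le_sum (f := L) (fun _ _ => Nat.zero_le _)
    (Finset.mem_univ _)
  let i : Fin K := ⟨0, by omega⟩
  let j : Fin K := ⟨1, by omega⟩
  let m : Fin N := ⟨0, by omega⟩
  let n : Fin N := ⟨1, by omega⟩
  have hij : j ≠ i := by simp [i, j]
  have hmn : n ≠ m := by simp [m, n]
  let d : Fin K → Fin N := fun k => if k = i then m else n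
  have hdi : d i = m := if_pos rfl
  have hdj : d j = n := if_neg hij
  have hs := hsec d i
  have hd := hdec d j
  rw [hlam1 i (by simp only [i]; omega)] at hs
  rw [hlam1 j (by simp only [j]; omega), hdj] at hd
  have h1 := ent_add_le_of_mutInf_eq_zero hp0 hp1 (A' := W n)
    (C' := fun ω => (X d ω, Z ⟨0, hΛ⟩ ω)) hs
    (fun ω ω' e => congrFun e ⟨n, hdi ▸ hmn⟩)
    (fun ω ω' e => by simp_all)
  have h2 : ent p (fun ω => (W n ω, (X d ω, Z ⟨0, hΛ⟩ ω))) ≤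
      ent p (fun ω => (W n ω, (X d ω, Z ⟨0, hΛ⟩ ω, U j ω))) :=
    ent_le_of_determines hp0 fun ω ω' e => by simp_all
  have h3 : ent p (fun ω => (X d ω, Z ⟨0, hΛ⟩ ω, U j ω)) ≤
      ent p (fun ω => ((X d ω, Z ⟨0, hΛ⟩ ω), U j ω)) :=
    ent_le_of_determines hp0 fun ω ω' e => by simp_all
  have h4 := ent_prod_le hp0 hp1 (fun ω => (X d ω, Z ⟨0, hΛ⟩ ω)) (U j)
  have h5 := ent_uniform hp1 (hWunif n)
  have h6 := hU j
  unfold condEnt at hd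
  have hBpos : (0 : ℝ) < B := by exact_mod_cast hB
  have hMU : 1 ≤ MU := le_of_mul_le_mul_right (by linarith : 1 * (B : ℝ) ≤ MU * B) hBpos
  have hL2 : (2 : ℝ) ≤ L ⟨0, hΛ⟩ := by exact_mod_cast hL1
  exact ⟨by nlinarith, hMU⟩
end
end
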